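/- arXiv:1212.3898 — 2 statements merged into one kernel-verified Lean document; each statement's English description precedes it below -/
import Mathlib

section
/- Let G be a connected, non-complete finite simple graph with maximum degree Δ ≥ 3. Then for every proper vertex coloring f : V(G) → {1, …, Δ} there exists a half-edge coloring h : E(G^{1/2}) → {1, …, Δ} such that f and h are 2-incompatible, i.e., every vertex u of G is incident to at most 2 half-edges e_{uv} with h(e_{uv}) = f(v). -/
open SimpleGraph

/-- Representations of vertices of the `n`-subdivision of `G`: `(u, u, 0)` represents the
branch vertex `u`, and for an adjacent pair `(u, v)`, the triple `(u, v, i)` with `i ≤ n`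
represents the point at distance `i` from `u` on the path of length `n` replacing the
edge `uv`. -/
def SubdivPre {V : Type*} (G : SimpleGraph V) (n : ℕ) : Type _ :=
  {p : V × V × ℕ // (p.1 = p.2.1 ∧ p.2.2 = 0) ∨ (G.Adj p.1 p.2.1 ∧ p.2.2 ≤ n)}

/-- The identifications between representations: `(u, v, i)` and `(v, u, n - i)` represent
the same point, and `(u, v, 0)` represents the branch vertex `u`, i.e. `(u, u, 0)`. -/
inductive SubdivRel {V : Type*} (G : SimpleGraph V) (n : ℕ) :
    SubdivPre G n → SubdivPre G n → Prop
  | flip (u v : V) (i : ℕ) (h : G.Adj u v) (hi : i ≤ n) :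
      SubdivRel G n ⟨(u, v, i), Or.inr ⟨h, hi⟩⟩
        ⟨(v, u, n - i), Or.inr ⟨h.symm, Nat.sub_le n i⟩⟩
  | collapse (u v : V) (h : G.Adj u v) :
      SubdivRel G n ⟨(u, v, 0), Or.inr ⟨h, Nat.zero_le n⟩⟩ ⟨(u, u, 0), Or.inl ⟨rfl, rfl⟩⟩

/-- The vertex set of the `n`-subdivision of `G`. -/
def SubdivVert {V : Type*} (G : SimpleGraph V) (n : ℕ) : Type _ := Quot (SubdivRel G n)

/-- The branch vertex of the subdivision corresponding to a vertex `u` of `G`. -/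
def branchVertex {V : Type*} (G : SimpleGraph V) (n : ℕ) (u : V) : SubdivVert G n :=
  Quot.mk _ ⟨(u, u, 0), Or.inl ⟨rfl, rfl⟩⟩

/-- The vertex `(uv)_i` of the subdivision: the point at distance `i` from `u` on the
path of length `n` replacing the edge `uv`. -/
def mkVert {V : Type*} (G : SimpleGraph V) (n : ℕ) {u v : V} (h : G.Adj u v)
    (i : ℕ) (hi : i ≤ n) : SubdivVert G n :=
  Quot.mk _ ⟨(u, v, i), Or.inr ⟨h, hi⟩⟩

/-- The `n`-subdivision `G^{1/n}` of `G`: each edge of `G` is replaced by a path of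
length `n`; consecutive points on such a path are adjacent. -/
def subdivision {V : Type*} (G : SimpleGraph V) (n : ℕ) : SimpleGraph (SubdivVert G n) :=
  SimpleGraph.fromRel (fun x y => ∃ (u v : V) (h : G.Adj u v) (i : ℕ) (hi : i < n),
    x = mkVert G n h i (le_of_lt hi) ∧ y = mkVert G n h (i + 1) hi)

/-- The `m`-power of a graph: two distinct vertices are adjacent iff their distance is
at most `m`, i.e. iff there is a walk of length at most `m` between them. -/
def powerGraph {W : Type*} (H : SimpleGraph W) (m : ℕ) : SimpleGraph W :=
  SimpleGraph.fromRel (fun x y => ∃ w : H.Walk x y, w.length ≤ m)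

/-- The fractional power `G^{m/n}`, the `m`-power of the `n`-subdivision of `G`. -/
def fracPower {V : Type*} (G : SimpleGraph V) (m n : ℕ) : SimpleGraph (SubdivVert G n) :=
  powerGraph (subdivision G n) m

/-- The half-edge `e_{uv}`: the edge of the `2`-subdivision `G^{1/2}` joining the branch
vertex `u` to the subdivision vertex of the edge `uv`. -/
def halfEdge {V : Type*} (G : SimpleGraph V) {u v : V} (h : G.Adj u v) :
    Sym2 (SubdivVert G 2) :=
  s(branchVertex G 2 u, mkVert G 2 h 1 (by omega))

/-- `h` is a proper edge coloring of `H`: distinct edges sharing a vertex get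
different colors. -/
def IsProperEdgeColoring {W : Type*} (H : SimpleGraph W) (h : Sym2 W → ℕ) : Prop :=
  ∀ e₁ ∈ H.edgeSet, ∀ e₂ ∈ H.edgeSet, e₁ ≠ e₂ → (∃ x, x ∈ e₁ ∧ x ∈ e₂) → h e₁ ≠ h e₂

/-- Colors chosen at the vertex `u` towards its neighbours are acceptable. -/
def GoodAt {V : Type*} (G : SimpleGraph V) (D : ℕ) (f : V → ℕ) (u : V) (c : V → ℕ) : Prop :=
  (∀ v, G.Adj u v → 1 ≤ c v ∧ c v ≤ D) ∧
  (∀ v w, G.Adj u v → G.Adj u w → c v = c w → v = w) ∧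
  {v : V | G.Adj u v ∧ c v = f v}.ncard ≤ 2

/-- Partial half-edge colorings; `U` is the set of uncolored vertices. -/
def PState {V : Type*} (G : SimpleGraph V) (D : ℕ) (f : V → ℕ) (U : Finset V)
    (h : V → V → ℕ) : Prop :=
  (∀ u ∈ U, ∀ v, h u v = 0) ∧ (∀ u, u ∉ U → GoodAt G D f u (h u)) ∧
  (∀ u v, u ∉ U → G.Adj u v → h u v ≠ h v u)

open Classical in
theorem ext_aux {V : Type*} [Fintype V] (G : SimpleGraph V) [DecidableRel G.Adj]
    (D : ℕ) (hD : 3 ≤ D) (f g : V → ℕ) (u p x : V) (hdeg : G.degree u ≤ D)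
    (hp : G.Adj u p) (hx : G.Adj u x) (hpx : g p ≠ g x ∨ G.degree u < D) :
    ∃ c : V → ℕ, GoodAt G D f u c ∧ ∀ v, G.Adj u v → c v ≠ g v := by
  let t : G.neighborFinset u → Finset ℕ := fun v =>
    ((Finset.Icc 1 D).erase (g v)) \ (if (v : V) = p ∨ (v : V) = x then ∅ else {f v})
  have card1 : ∀ a : ℕ, D - 1 ≤ ((Finset.Icc 1 D).erase a).card := by
    intro a
    have := Finset.pred_card_le_card_erase (s := Finset.Icc 1 D) (a := a)
    simpa using this
  have card2 : ∀ v, D - 2 ≤ (t v).card := by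
    intro v
    have h1 := card1 (g v)
    have h2 := Finset.le_card_sdiff
      (if (v : V) = p ∨ (v : V) = x then ∅ else {f v}) ((Finset.Icc 1 D).erase (g v))
    have h3 : (if (v : V) = p ∨ (v : V) = x then (∅ : Finset ℕ) else {f v}).card ≤ 1 := by
      split_ifs <;> simp
    show D - 2 ≤ (_ \ _ : Finset ℕ).card
    omega
  have tsp : ∀ v : G.neighborFinset u, ((v : V) = p ∨ (v : V) = x) →
      t v = (Finset.Icc 1 D).erase (g v) := by
    intro v hv
    simp [t, hv]
  have hall : ∀ S : Finset (G.neighborFinset u), S.card ≤ (S.biUnion t).card := by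
    intro S
    rcases S.eq_empty_or_nonempty with rfl | ⟨v0, hv0⟩
    · simp
    have sub : ∀ v ∈ S, (t v).card ≤ (S.biUnion t).card := fun v hv =>
      Finset.card_le_card (Finset.subset_biUnion_of_mem t hv)
    let S' : Finset V := S.map (Function.Embedding.subtype _)
    have hS' : S'.card = S.card := Finset.card_map _
    have hS'N : S' ⊆ G.neighborFinset u := by
      intro y hy
      simp only [S', Finset.mem_map] at hy
      obtain ⟨y', _, rfl⟩ := hy
      exact y'.2
    have hmem : ∀ y (hy : y ∈ G.neighborFinset u), y ∈ S' ↔ (⟨y, hy⟩ : G.neighborFinset u) ∈ S := by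
      intro y hy
      simp only [S', Finset.mem_map]
      constructor
      · rintro ⟨y', hy', rfl⟩
        exact hy'
      · intro h
        exact ⟨_, h, rfl⟩
    have hpN : p ∈ G.neighborFinset u := by simpa using hp
    have hxN : x ∈ G.neighborFinset u := by simpa using hx
    have hcN : (G.neighborFinset u).card = G.degree u := rfl
    have hSle : S'.card ≤ G.degree u := Finset.card_le_card hS'N
    by_cases h1 : p ∈ S'
    · have k1 := sub _ ((hmem p hpN).1 h1)
      rw [tsp _ (Or.inl rfl)] at k1
      have k1' := card1 (g p)
      by_cases h2 : x ∈ S'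
      · by_cases h3 : g p = g x
        · have : G.degree u < D := hpx.resolve_left (by simpa using h3)
          simp only at k1
          omega
        · have : Finset.Icc 1 D ⊆ S.biUnion t := by
            intro a ha
            rw [Finset.mem_biUnion]
            by_cases h4 : a = g p
            · refine ⟨_, (hmem x hxN).1 h2, ?_⟩
              rw [tsp _ (Or.inr rfl)]
              simp only [Finset.mem_erase]
              exact ⟨by rw [h4]; exact h3, ha⟩
            · refine ⟨_, (hmem p hpN).1 h1, ?_⟩
              rw [tsp _ (Or.inl rfl)]
              simp only [Finset.mem_erase]
              exact ⟨h4, ha⟩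
          have := Finset.card_le_card this
          simp at this
          omega
      · have : S'.card < (G.neighborFinset u).card :=
          Finset.card_lt_card ⟨hS'N, fun h => h2 (h hxN)⟩
        simp only at k1
        omega
    · have lt1 : S'.card < (G.neighborFinset u).card :=
          Finset.card_lt_card ⟨hS'N, fun h => h1 (h hpN)⟩
      by_cases h2 : x ∈ S'
      · have k1 := sub _ ((hmem x hxN).1 h2)
        rw [tsp _ (Or.inr rfl)] at k1
        have k1' := card1 (g x)
        simp only at k1
        omega
      · have k := sub _ hv0
        have k2 := card2 v0
        rcases hpx with h3 | h3
        · have hne : p ≠ x := fun h => h3 (by rw [h])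
          have e1 : S' ⊆ ((G.neighborFinset u).erase p).erase x := by
            intro y hy
            simp only [Finset.mem_erase]
            exact ⟨fun h => h2 (h ▸ hy), fun h => h1 (h ▸ hy), hS'N hy⟩
          have e2 := Finset.card_le_card e1
          rw [Finset.card_erase_of_mem (by simp [hx, hne.symm]),
            Finset.card_erase_of_mem hpN] at e2
          omega
        · omega
  obtain ⟨c, cinj, hc⟩ := (Finset.all_card_le_biUnion_card_iff_exists_injective t).1 hall
  have hN : ∀ v, G.Adj u v → v ∈ G.neighborFinset u := fun v hv => by simpa using hv
  refine ⟨fun v => if hv : v ∈ G.neighborFinset u then c ⟨v, hv⟩ else 0, ⟨?_, ?_, ?_⟩, ?_⟩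
  · intro v hv
    have := hc ⟨v, hN v hv⟩
    simp only [t, Finset.mem_sdiff, Finset.mem_erase, Finset.mem_Icc] at this
    simp only [hN v hv, dif_pos]
    exact this.1.2
  · intro v w hv hw he
    simp only [hN v hv, hN w hw, dif_pos] at he
    exact congrArg Subtype.val (cinj he)
  · have : {v : V | G.Adj u v ∧
        (if hv : v ∈ G.neighborFinset u then c ⟨v, hv⟩ else 0) = f v} ⊆ {p, x} := by
      rintro v ⟨hv, he⟩
      simp only [hN v hv, dif_pos] at he
      by_contra hcon
      have h0 : ¬ (v = p ∨ v = x) := by simpa using hcon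
      have := hc ⟨v, hN v hv⟩
      simp only [t, Finset.mem_sdiff, h0, if_false, Finset.mem_singleton] at this
      exact this.2 he
    exact (Set.ncard_le_ncard this (Set.toFinite _)).trans ((Set.ncard_insert_le _ _).trans (by simp))
  · intro v hv
    have := hc ⟨v, hN v hv⟩
    simp only [t, Finset.mem_sdiff, Finset.mem_erase] at this
    simp only [hN v hv, dif_pos]
    exact this.1.1

theorem ext_lem {V : Type*} [Fintype V] (G : SimpleGraph V) [DecidableRel G.Adj]
    (D : ℕ) (hD : 3 ≤ D) (f g : V → ℕ) (u : V) (hdeg : G.degree u ≤ D)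
    (hpx : (∃ p x, G.Adj u p ∧ G.Adj u x ∧ g p ≠ g x) ∨ G.degree u < D) :
    ∃ c : V → ℕ, GoodAt G D f u c ∧ ∀ v, G.Adj u v → c v ≠ g v := by
  rcases hpx with ⟨p, x, hp, hx, h⟩ | h
  · exact ext_aux G D hD f g u p x hdeg hp hx (Or.inl h)
  · by_cases hN : ∃ p, G.Adj u p
    · obtain ⟨p, hp⟩ := hN
      exact ext_aux G D hD f g u p p hdeg hp hp (Or.inr h)
    · push Not at hN
      refine ⟨fun _ => 0, ⟨fun v hv => absurd hv (hN v), fun v w hv => absurd hv (hN v), ?_⟩,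
        fun v hv => absurd hv (hN v)⟩
      simp [hN]

/-- Recoloring / coloring a vertex of a partial state. -/
theorem PState.recolor {V : Type*} [DecidableEq V] {G : SimpleGraph V} {D : ℕ} {f : V → ℕ}
    {U : Finset V} {h : V → V → ℕ} (hs : PState G D f U h) (r : V) (c : V → ℕ)
    (hc : GoodAt G D f r c) (hc2 : ∀ v, G.Adj r v → c v ≠ h v r) :
    PState G D f (U.erase r) (Function.update h r c) := by
  obtain ⟨h1, h2, h3⟩ := hs
  refine ⟨?_, ?_, ?_⟩
  · intro u hu v
    simp only [Finset.mem_erase] at hu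
    rw [Function.update_of_ne hu.1]
    exact h1 u hu.2 v
  · intro u hu
    by_cases e : u = r
    · subst e; simpa using hc
    · rw [Function.update_of_ne e]
      exact h2 u (fun hh => hu (Finset.mem_erase.2 ⟨e, hh⟩))
  · intro u v hu huv
    by_cases e : u = r
    · subst e
      rw [Function.update_self, Function.update_of_ne huv.ne']
      exact hc2 v huv
    · have hu' : u ∉ U := fun hh => hu (Finset.mem_erase.2 ⟨e, hh⟩)
      rw [Function.update_of_ne e]
      by_cases e2 : v = r
      · subst e2
        rw [Function.update_self]
        exact (hc2 u huv.symm).symm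
      · rw [Function.update_of_ne e2]
        exact h3 u v hu' huv

/-- Uncoloring a vertex of a partial state. -/
theorem PState.uncolor {V : Type*} [DecidableEq V] {G : SimpleGraph V} {D : ℕ} {f : V → ℕ}
    {U : Finset V} {h : V → V → ℕ} (hs : PState G D f U h) (r : V) :
    PState G D f (insert r U) (Function.update h r (fun _ => 0)) := by
  obtain ⟨h1, h2, h3⟩ := hs
  refine ⟨?_, ?_, ?_⟩
  · intro u hu v
    by_cases e : u = r
    · subst e; simp
    · rw [Function.update_of_ne e]
      exact h1 u ((Finset.mem_insert.1 hu).resolve_left e) v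
  · intro u hu
    simp only [Finset.mem_insert, not_or] at hu
    rw [Function.update_of_ne hu.1]
    exact h2 u hu.2
  · intro u v hu huv
    simp only [Finset.mem_insert, not_or] at hu
    rw [Function.update_of_ne hu.1]
    by_cases e2 : v = r
    · subst e2
      rw [Function.update_self]
      have := ((h2 u hu.2).1 v huv).1
      show h u v ≠ 0
      omega
    · rw [Function.update_of_ne e2]
      exact h3 u v hu.2 huv

open Classical in
theorem exists_full {V : Type*} [Fintype V] (G : SimpleGraph V) [DecidableRel G.Adj]
    (hconn : G.Connected) (D : ℕ) (hD : 3 ≤ D) (hdeg : ∀ u, G.degree u ≤ D) (f : V → ℕ) :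
    ∃ h : V → V → ℕ, PState G D f ∅ h := by
  -- a state with as few uncolored vertices as possible
  have hex : ∃ n, ∃ (U : Finset V) (h : V → V → ℕ), PState G D f U h ∧ U.card = n :=
    ⟨_, Finset.univ, fun _ _ => 0, ⟨by simp, by simp, by simp⟩, rfl⟩
  obtain ⟨U, h, hs, hcard⟩ := Nat.find_spec hex
  have hmin : ∀ (U' : Finset V) (h' : V → V → ℕ), PState G D f U' h' → U.card ≤ U'.card := by
    intro U' h' hs'
    rw [hcard]
    exact Nat.find_min' hex ⟨U', h', hs', rfl⟩
  rcases U.eq_empty_or_nonempty with rfl | ⟨r, hr⟩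
  · exact ⟨h, hs⟩
  exfalso
  -- a hole in a minimal state cannot be colored
  have nocol : ∀ (U' : Finset V) (h' : V → V → ℕ), PState G D f U' h' → U'.card = U.card →
      ∀ x ∈ U', ∀ c, GoodAt G D f x c → ¬ ∀ v, G.Adj x v → c v ≠ h' v x := by
    intro U' h' hs' hc' x hx c hc hc2
    have := hmin _ _ (hs'.recolor x c hc hc2)
    rw [Finset.card_erase_of_mem hx] at this
    have : 0 < U'.card := Finset.card_pos.2 ⟨x, hx⟩
    omega
  have stuck : ∀ (U' : Finset V) (h' : V → V → ℕ), PState G D f U' h' → U'.card = U.card →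
      ∀ x ∈ U', G.degree x = D ∧ ∀ v w, G.Adj x v → G.Adj x w → h' v x = h' w x := by
    intro U' h' hs' hc' x hx
    by_contra hcon
    have : (∃ p q, G.Adj x p ∧ G.Adj x q ∧ h' p x ≠ h' q x) ∨ G.degree x < D := by
      by_contra h0
      push Not at h0
      exact hcon ⟨le_antisymm (hdeg x) h0.2, fun v w hv hw => h0.1 v w hv hw⟩
    obtain ⟨c, hc, hc2⟩ := ext_lem G D hD f (fun v => h' v x) x (hdeg x) this
    exact nocol U' h' hs' hc' x hx c hc hc2
  -- another neighbour
  have other : ∀ x y, G.degree x = D → ∃ z, G.Adj x z ∧ z ≠ y := by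
    intro x y hx
    have : 1 < (G.neighborFinset x).card := by
      rw [SimpleGraph.card_neighborFinset_eq_degree]; omega
    obtain ⟨z, hz, hne⟩ := Finset.exists_mem_ne this y
    exact ⟨z, by simpa using hz, hne⟩
  -- uncolored vertices have no uncolored neighbours
  have stuckne : ∀ (U' : Finset V) (h' : V → V → ℕ), PState G D f U' h' → U'.card = U.card →
      ∀ x ∈ U', ∀ v, G.Adj x v → h' v x ≠ 0 := by
    intro U' h' hs' hc' x hx v hv h0
    obtain ⟨hd, hst⟩ := stuck U' h' hs' hc' x hx
    obtain ⟨z, hz, hzv⟩ := other x v hd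
    obtain ⟨c, hc, hc2⟩ := ext_lem G D hD f (Function.update (fun _ => 0) v 1) x (hdeg x)
      (Or.inl ⟨v, z, hv, hz, by simp [hzv]⟩)
    refine nocol U' h' hs' hc' x hx c hc ?_
    intro w hw
    rw [hst w v hw hv, h0]
    have := (hc.1 w hw).1
    omega
  obtain ⟨hdr, hstr⟩ := stuck U h hs rfl r hr
  obtain ⟨v0, hv0, -⟩ := other r r hdr
  obtain ⟨a, ha⟩ : ∃ a, a = h v0 r := ⟨_, rfl⟩
  have ha0 : a ≠ 0 := by rw [ha]; exact stuckne U h hs rfl r hr v0 hv0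
  -- move the hole around
  have key : ∀ x, ∃ (U' : Finset V) (h' : V → V → ℕ), PState G D f U' h' ∧ U'.card = U.card ∧
      x ∈ U' ∧ (∀ v, G.Adj x v → h' v x = a) ∧
      ∀ y z, G.Adj y z → h' y z = a → h y z = a ∨ h z y = a := by
    intro x
    have hreach := (SimpleGraph.reachable_iff_reflTransGen r x).1 (hconn.preconnected r x)
    induction hreach with
    | refl => exact ⟨U, h, hs, rfl, hr, fun v hv => by rw [ha]; exact hstr v v0 hv hv0,
        fun y z _ hyz => Or.inl hyz⟩
    | @tail x v _ hxv ih =>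
      obtain ⟨U', h', hs', hc', hx, hxa, hA⟩ := ih
      obtain ⟨hdx, -⟩ := stuck U' h' hs' hc' x hx
      have hvU : v ∉ U' := fun hv => stuckne U' h' hs' hc' x hx v hxv (hs'.1 v hv x)
      obtain ⟨v', hv', hne⟩ := other x v hdx
      -- all other half-edges into `v` have color `a`
      have claim2 : ∀ w, G.Adj v w → w ≠ x → h' w v = a := by
        intro w hw hwx
        by_contra hcon
        obtain ⟨c, hc, hc2⟩ := ext_lem G D hD f (Function.update (fun y => h' y v) x a) v (hdeg v)
          (Or.inl ⟨w, x, hw, hxv.symm, by simpa [hwx] using hcon⟩)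
        have hs2 := hs'.recolor v c hc (by
          intro y hy
          by_cases e : y = x
          · subst e
            rw [hs'.1 y hx v]
            have := (hc.1 y hy).1
            omega
          · have := hc2 y hy
            rwa [Function.update_of_ne e] at this)
        rw [Finset.erase_eq_of_notMem hvU] at hs2
        have := (stuck U' _ hs2 hc' x hx).2 v v' hxv hv'
        rw [Function.update_self, Function.update_of_ne hne, hxa v' hv'] at this
        have h9 := hc2 x hxv.symm
        rw [Function.update_self] at h9
        exact h9 this
      obtain ⟨c, hc, hc2⟩ := ext_lem G D hD f (Function.update (fun y => h' y x) v 0) x (hdeg x)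
          (Or.inl ⟨v', v, hv', hxv, by simpa [hne, hxa v' hv'] using ha0⟩)
      have hs2 := (hs'.uncolor v).recolor x c hc (by
        intro y hy
        have := hc2 y hy
        by_cases e : y = v
        · subst e; simpa using this
        · rw [Function.update_of_ne e] at this ⊢; exact this)
      have hc2' : ((insert v U').erase x).card = U.card := by
        rw [Finset.card_erase_of_mem (Finset.mem_insert_of_mem hx),
          Finset.card_insert_of_notMem hvU]
        omega
      have hvm : v ∈ (insert v U').erase x := by simp [hxv.ne']
      obtain ⟨hdv, hstv⟩ := stuck _ _ hs2 hc2' v hvm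
      obtain ⟨w, hw, hwx⟩ := other v x hdv
      refine ⟨_, _, hs2, hc2', hvm, ?_, ?_⟩
      · intro y hy
        rw [hstv y w hy hw, Function.update_of_ne hwx, Function.update_of_ne hw.ne']
        exact claim2 w hw hwx
      · intro y z hyz he
        by_cases e : y = x
        · subst e
          exact (hA z y hyz.symm (hxa z hyz)).symm
        · rw [Function.update_of_ne e] at he
          by_cases e2 : y = v
          · subst e2
            rw [Function.update_self] at he
            exact absurd he.symm ha0
          · rw [Function.update_of_ne e2] at he
            exact hA y z hyz he
  have hdegD : ∀ x, G.degree x = D := by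
    intro x
    obtain ⟨U', h', hs', hc', hx, -⟩ := key x
    exact (stuck U' h' hs' hc' x hx).1
  have hcov : ∀ x v, G.Adj x v → h x v = a ∨ h v x = a := by
    intro x v hxv
    obtain ⟨U', h', hs', hc', hx, hxa, hA⟩ := key x
    exact (hA v x hxv.symm (hxa v hxv)).symm
  have hone : ∀ x, (∑ y, if G.Adj x y ∧ h x y = a then 1 else 0) ≤ 1 := by
    intro x
    rw [← Finset.card_filter, Finset.card_le_one]
    intro y hy z hz
    simp only [Finset.mem_filter, Finset.mem_univ, true_and] at hy hz
    by_cases hxU : x ∈ U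
    · exact absurd (hy.2.symm.trans (hs.1 x hxU y)) ha0
    · exact (hs.2.1 x hxU).2.1 y z hy.1 hz.1 (hy.2.trans hz.2.symm)
  have hsum : ∑ x : V, D ≤ ∑ x : V, 2 := by
    calc ∑ x : V, D = ∑ x : V, ∑ y : V, (if G.Adj x y then 1 else 0) := by
          refine Finset.sum_congr rfl fun x _ => ?_
          rw [← hdegD x, ← Finset.card_filter, ← SimpleGraph.card_neighborFinset_eq_degree]
          congr 1
          ext y; simp
      _ ≤ ∑ x : V, ∑ y : V, ((if G.Adj x y ∧ h x y = a then 1 else 0) +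
            (if G.Adj y x ∧ h y x = a then 1 else 0)) := by
          refine Finset.sum_le_sum fun x _ => Finset.sum_le_sum fun y _ => ?_
          by_cases e : G.Adj x y
          · rcases hcov x y e with h1 | h1 <;> simp [e, e.symm, h1]
          · simp [e]
      _ = (∑ x : V, ∑ y : V, (if G.Adj x y ∧ h x y = a then 1 else 0)) +
            ∑ x : V, ∑ y : V, (if G.Adj x y ∧ h x y = a then 1 else 0) := by
          simp only [Finset.sum_add_distrib]
          congr 1
          exact Finset.sum_comm
      _ ≤ (∑ x : V, 1) + ∑ x : V, 1 :=
          add_le_add (Finset.sum_le_sum fun x _ => hone x) (Finset.sum_le_sum fun x _ => hone x)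
      _ = ∑ x : V, 2 := by rw [← Finset.sum_add_distrib]
  simp only [Finset.sum_const, smul_eq_mul] at hsum
  have hpos : 0 < (Finset.univ : Finset V).card := Finset.card_pos.2 ⟨r, Finset.mem_univ r⟩
  have := Nat.le_of_mul_le_mul_left hsum hpos
  omega

/-- Locate a vertex of the 2-subdivision. -/
def locPre {V : Type*} (G : SimpleGraph V) (p : SubdivPre G 2) : V ⊕ Sym2 V :=
  if p.1.2.2 = 0 then Sum.inl p.1.1
  else if p.1.2.2 = 1 then Sum.inr s(p.1.1, p.1.2.1) else Sum.inl p.1.2.1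

/-- The descent of `locPre` to the 2-subdivision. -/
def locVert {V : Type*} (G : SimpleGraph V) : SubdivVert G 2 → V ⊕ Sym2 V :=
  Quot.lift (locPre G) (by
    intro p q hpq
    cases hpq with
    | flip u v i h hi =>
      interval_cases i
      · simp [locPre]
      · simp [locPre, Sym2.eq_swap]
      · simp [locPre]
    | collapse u v h => simp [locPre])

theorem locVert_branch {V : Type*} (G : SimpleGraph V) (u : V) :
    locVert G (branchVertex G 2 u) = Sum.inl u := by
  simp [locVert, branchVertex, locPre]

theorem locVert_mid {V : Type*} (G : SimpleGraph V) {u v : V} (h : G.Adj u v) (hi : 1 ≤ 2) :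
    locVert G (mkVert G 2 h 1 hi) = Sum.inr s(u, v) := by
  simp [locVert, mkVert, locPre]

theorem halfEdge_inj {V : Type*} (G : SimpleGraph V) {u v u' v' : V} (h : G.Adj u v)
    (h' : G.Adj u' v') (he : halfEdge G h = halfEdge G h') : u = u' ∧ v = v' := by
  have := congrArg (Sym2.map (locVert G)) he
  simp only [halfEdge, Sym2.map_mk, locVert_branch, locVert_mid, Sym2.eq_iff] at this
  simp at this
  obtain ⟨rfl, h2⟩ := this
  exact ⟨rfl, by rcases h2 with h2 | ⟨h2, h3⟩ <;> simp_all⟩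

theorem edge_is_halfEdge {V : Type*} (G : SimpleGraph V) (e : Sym2 (SubdivVert G 2))
    (he : e ∈ (subdivision G 2).edgeSet) : ∃ (u v : V) (h : G.Adj u v), e = halfEdge G h := by
  have aux : ∀ x y : SubdivVert G 2, (∃ (u v : V) (h : G.Adj u v) (i : ℕ) (hi : i < 2),
      x = mkVert G 2 h i (le_of_lt hi) ∧ y = mkVert G 2 h (i + 1) hi) →
      ∃ (u v : V) (h : G.Adj u v), s(x, y) = halfEdge G h := by
    rintro x y ⟨u, v, h, i, hi, rfl, rfl⟩
    interval_cases i
    · refine ⟨u, v, h, ?_⟩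
      have : mkVert G 2 h 0 (by omega) = branchVertex G 2 u :=
        Quot.sound (SubdivRel.collapse u v h)
      rw [this]
      rfl
    · refine ⟨v, u, h.symm, ?_⟩
      have e1 : mkVert G 2 h 1 (by omega) = mkVert G 2 h.symm 1 (by omega) :=
        Quot.sound (SubdivRel.flip u v 1 h (by omega))
      have e2 : mkVert G 2 h 2 (by omega) = mkVert G 2 h.symm 0 (by omega) :=
        Quot.sound (SubdivRel.flip u v 2 h (by omega))
      have e3 : mkVert G 2 h.symm 0 (by omega) = branchVertex G 2 v :=
        Quot.sound (SubdivRel.collapse v u h.symm)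
      show s(mkVert G 2 h 1 _, mkVert G 2 h 2 _) = _
      rw [e1, e2, e3, Sym2.eq_swap]
      rfl
  induction e using Sym2.ind with
  | _ x y =>
    rw [SimpleGraph.mem_edgeSet, subdivision, SimpleGraph.fromRel_adj] at he
    rcases he.2 with h | h
    · exact aux x y h
    · rw [Sym2.eq_swap]; exact aux y x h

theorem exists_two_incompatible_halfEdge_coloring {V : Type*} [Fintype V]
    (G : SimpleGraph V) [DecidableRel G.Adj]
    (hconn : G.Connected) (hnc : G ≠ ⊤) (hΔ : 3 ≤ G.maxDegree)
    (f : V → ℕ) (hf1 : ∀ v, f v ∈ Finset.Icc 1 G.maxDegree)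
    (hfproper : ∀ u v : V, G.Adj u v → f u ≠ f v) :
    ∃ h : Sym2 (SubdivVert G 2) → ℕ,
      (∀ e ∈ (subdivision G 2).edgeSet, h e ∈ Finset.Icc 1 G.maxDegree) ∧
      IsProperEdgeColoring (subdivision G 2) h ∧
      ∀ u : V, {v : V | ∃ huv : G.Adj u v, h (halfEdge G huv) = f v}.ncard ≤ 2 := by
  classical
  obtain ⟨c, -, hc2, hc3⟩ := exists_full G hconn G.maxDegree hΔ (fun u => G.degree_le_maxDegree u) f
  let h : Sym2 (SubdivVert G 2) → ℕ := fun e =>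
    if he : ∃ p : V × V, ∃ hp : G.Adj p.1 p.2, e = halfEdge G hp then
      c he.choose.1 he.choose.2 else 0
  have hh : ∀ {u v : V} (huv : G.Adj u v), h (halfEdge G huv) = c u v := by
    intro u v huv
    have he : ∃ p : V × V, ∃ hp : G.Adj p.1 p.2, halfEdge G huv = halfEdge G hp :=
      ⟨(u, v), huv, rfl⟩
    obtain ⟨hp, hpe⟩ := he.choose_spec
    obtain ⟨e1, e2⟩ := halfEdge_inj G huv hp hpe
    show (if he : ∃ p : V × V, ∃ hp : G.Adj p.1 p.2, halfEdge G huv = halfEdge G hp then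
      c he.choose.1 he.choose.2 else 0) = _
    rw [dif_pos he, ← e1, ← e2]
  refine ⟨h, ?_, ?_, ?_⟩
  · intro e he
    obtain ⟨u, v, huv, rfl⟩ := edge_is_halfEdge G e he
    rw [hh, Finset.mem_Icc]
    exact (hc2 u (by simp)).1 v huv
  · intro e₁ he₁ e₂ he₂ hne hx
    obtain ⟨u, v, huv, rfl⟩ := edge_is_halfEdge G e₁ he₁
    obtain ⟨u', v', huv', rfl⟩ := edge_is_halfEdge G e₂ he₂
    obtain ⟨x, hx1, hx2⟩ := hx
    rw [hh, hh]
    simp only [halfEdge, Sym2.mem_iff] at hx1 hx2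
    rcases hx1 with rfl | rfl <;> rcases hx2 with hx2 | hx2 <;>
      replace hx2 := congrArg (locVert G) hx2 <;>
      simp only [locVert_branch, locVert_mid, Sum.inl.injEq, Sum.inr.injEq, reduceCtorEq] at hx2
    · subst hx2
      intro hcc
      have := (hc2 u (by simp)).2.1 v v' huv huv' hcc
      subst this
      exact hne rfl
    · rcases Sym2.eq_iff.1 hx2 with ⟨rfl, rfl⟩ | ⟨rfl, rfl⟩
      · exact absurd rfl hne
      · exact hc3 u v (by simp) huv
  · intro u
    have : {v : V | ∃ huv : G.Adj u v, h (halfEdge G huv) = f v} =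
        {v : V | G.Adj u v ∧ c u v = f v} := by
      ext v
      constructor
      · rintro ⟨huv, he⟩
        exact ⟨huv, by rw [← hh huv]; exact he⟩
      · rintro ⟨huv, he⟩
        exact ⟨huv, by rw [hh huv]; exact he⟩
    rw [this]
    exact (hc2 u (by simp)).2.2
end

section
/- Let m be an odd integer with m ≥ 3 and let G be a non-complete finite simple graph with maximum degree Δ ≥ 5. If there exist a proper vertex coloring f : V(G) → {1, …, Δ} and a half-edge coloring h : E(G^{1/2}) → {1, …, Δ} that are compatible (no half-edge e_{uv} satisfies h(e_{uv}) = f(v)), then χ(G^{m/n}) = ω(G^{m/n}) for every integer n with n > m. -/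
open SimpleGraph

/-- The palette of colours: two special colours on level `0` and `d` colours on each of the
levels `1, …, k`. -/
def fpPal (d k : ℕ) (c : ℕ × ℕ) : Prop :=
  (c.2 = 0 ∧ (c.1 = 1 ∨ c.1 = 2)) ∨ (1 ≤ c.2 ∧ c.2 ≤ k ∧ 1 ≤ c.1 ∧ c.1 ≤ d)

/-- Shifted half-edge colours. -/
def fpShift (β a i : ℕ) : ℕ × ℕ := if i = 1 then (3 - β, 0) else (a, i - 1)

/-- Colours near a branch vertex. -/
def fpBall (k β p a i : ℕ) : ℕ × ℕ :=
  if i = 0 then (β, 0) else if i = k + 1 then (a, k) else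
    if p = a then fpShift β a i else (p, i)

/-- Partial colouring of a subdivided edge, defined on the positions in `I`. -/
structure FpGood (k n d : ℕ) (gL gR : ℕ → ℕ × ℕ) (xL xR : ℕ × ℕ) (I : ℕ → Prop)
    (c : ℕ → ℕ × ℕ) : Prop where
  pal : ∀ i, i ≤ n → I i → fpPal d k (c i)
  win : ∀ i j, i < j → j ≤ n → I i → I j → j ≤ i + (2 * k + 1) → c i ≠ c j
  left : ∀ i, i ≤ k + 1 → c i = gL i
  right : ∀ i, i ≤ k + 1 → c (n - i) = gR i
  lvL : ∀ i, k + 2 ≤ i → i ≤ 2 * k + 1 → I i → 2 * k + 1 < i + (c i).2 ∨ (i = k + 2 ∧ c i = xL)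
  lvR : ∀ i, k + 2 ≤ i → i ≤ 2 * k + 1 → I (n - i) →
    2 * k + 1 < i + (c (n - i)).2 ∨ (i = k + 2 ∧ c (n - i) = xR)

theorem FpGood.flip {k n d : ℕ} {gL gR : ℕ → ℕ × ℕ} {xL xR : ℕ × ℕ} {I J : ℕ → Prop}
    {c : ℕ → ℕ × ℕ} (hn : 2 * k + 2 ≤ n) (h : FpGood k n d gL gR xL xR I c)
    (hJ : ∀ i, i ≤ n → J i → I (n - i)) :
    FpGood k n d gR gL xR xL J (fun i => c (n - i)) where
  pal i hi h1 := h.pal _ (Nat.sub_le _ _) (hJ i hi h1)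
  win i j hij hj h1 h2 h3 :=
    (h.win (n - j) (n - i) (by omega) (by omega) (hJ _ hj h2) (hJ _ (by omega) h1) (by omega)).symm
  left i hi := h.right i hi
  right i hi := by
    have : n - (n - i) = i := by omega
    simp only [this]; exact h.left i hi
  lvL i h1 h2 h3 := h.lvR i h1 h2 (hJ _ (by omega) h3)
  lvR i h1 h2 h3 := by
    have e : n - (n - i) = i := by omega
    have := hJ _ (by omega) h3
    rw [e] at this
    simp only [e]; exact h.lvL i h1 h2 this

theorem fp_extend {k n d s s' : ℕ} {gL gR : ℕ → ℕ × ℕ} {xL xR : ℕ × ℕ}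
    {c : ℕ → ℕ × ℕ} (hk : 1 ≤ k) (hn : 2 * k + 3 ≤ n) (hd : 5 ≤ d) (hs : 1 ≤ s)
    (hss : s' = s ∨ s' = s + 1)
    (hgL : ∀ i, i ≤ k → (gL i).2 ≤ i) (hgR : ∀ i, i ≤ k → (gR i).2 ≤ i)
    (h : FpGood k n d gL gR xL xR (fun i => i ≤ k + 1 + s ∨ n ≤ i + (k + 1 + s')) c) :
    ∃ c, FpGood k n d gL gR xL xR (fun i => i ≤ k + 1 + (s + 1) ∨ n ≤ i + (k + 1 + s')) c := by
  by_cases hin : n ≤ (k + 1 + (s + 1)) + (k + 1 + s')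
  · have key : ∀ i, (i ≤ k + 1 + (s + 1) ∨ n ≤ i + (k + 1 + s')) →
        (i ≤ k + 1 + s ∨ n ≤ i + (k + 1 + s')) := by intro i hi; omega
    exact ⟨c, fun i hi h1 => h.pal i hi (key _ h1),
      fun i j a b h1 h2 => h.win i j a b (key _ h1) (key _ h2), h.left, h.right,
      fun i a b h1 => h.lvL i a b (key _ h1), fun i a b h1 => h.lvR i a b (key _ h1)⟩
  obtain ⟨p, hp⟩ : ∃ p, p = k + 1 + (s + 1) := ⟨_, rfl⟩
  -- find a colour for position `p`
  have hcol : ∃ x : ℕ × ℕ, fpPal d k x ∧ 2 * k + 1 < p + x.2 + (if p ≤ 2 * k + 1 then 0 else 2 * k + 2) ∧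
      ∀ j, j ≤ n → (j ≤ k + 1 + s ∨ n ≤ j + (k + 1 + s')) → j ≤ p + (2 * k + 1) →
        p ≤ j + (2 * k + 1) → c j ≠ x := by
    by_cases hpk : p ≤ 2 * k + 1
    · let J : Finset ℕ := Finset.Icc (k + 1 - (s + 1)) (k + 1 + s) ∪
        Finset.Icc (n - (k + 1 + s')) (n - (k + 1 - (s + 1)))
      let P : Finset (ℕ × ℕ) := Finset.Icc 1 d ×ˢ Finset.Icc (k - s) k
      have hJ : (J.image c).card < P.card := by
        have h1 : (J.image c).card ≤ J.card := Finset.card_image_le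
        have h2 : J.card ≤ (Finset.Icc (k + 1 - (s + 1)) (k + 1 + s)).card +
          (Finset.Icc (n - (k + 1 + s')) (n - (k + 1 - (s + 1)))).card := Finset.card_union_le _ _
        rw [Nat.card_Icc, Nat.card_Icc] at h2
        have h3 : P.card = d * (s + 1) := by
          simp only [P, Finset.card_product, Nat.card_Icc]
          congr 1; omega
        rw [h3]
        have : 5 * (s + 1) ≤ d * (s + 1) := Nat.mul_le_mul_right _ hd
        omega
      obtain ⟨x, hx, hxJ⟩ := Finset.exists_mem_notMem_of_card_lt_card hJ
      simp only [P, Finset.mem_product, Finset.mem_Icc] at hx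
      refine ⟨x, Or.inr (by omega), by simp [hpk]; omega, ?_⟩
      intro j hjn hj _ _ hcx
      apply hxJ
      rw [Finset.mem_image]
      refine ⟨j, ?_, hcx⟩
      simp only [J, Finset.mem_union, Finset.mem_Icc]
      by_contra hcon
      by_cases hjk : j ≤ k
      · have := hgL j hjk
        rw [← h.left j (by omega), hcx] at this
        omega
      · have hjk' : n - j ≤ k := by omega
        have := hgR (n - j) hjk'
        rw [← h.right (n - j) (by omega), show n - (n - j) = j by omega, hcx] at this
        omega
    · let J : Finset ℕ := Finset.Icc (p - (2 * k + 1)) (p - 1) ∪ Finset.Icc (p + 1) (p + (2 * k + 1))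
      let P : Finset (ℕ × ℕ) := (Finset.Icc 1 d ×ˢ Finset.Icc 1 k) ∪ {(1, 0), (2, 0)}
      have hJ : (J.image c).card < P.card := by
        have h1 : (J.image c).card ≤ J.card := Finset.card_image_le
        have h2 : J.card ≤ (Finset.Icc (p - (2 * k + 1)) (p - 1)).card +
          (Finset.Icc (p + 1) (p + (2 * k + 1))).card := Finset.card_union_le _ _
        rw [Nat.card_Icc, Nat.card_Icc] at h2
        have h3 : P.card = d * k + 2 := by
          simp only [P]
          rw [Finset.card_union_of_disjoint]
          · simp
          · rw [Finset.disjoint_left]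
            rintro ⟨a, b⟩ hab
            simp at hab ⊢
            omega
        rw [h3]
        have : 5 * k ≤ d * k := Nat.mul_le_mul_right _ hd
        omega
      obtain ⟨x, hx, hxJ⟩ := Finset.exists_mem_notMem_of_card_lt_card hJ
      refine ⟨x, ?_, by simp [hpk]; omega, ?_⟩
      · obtain ⟨x1, x2⟩ := x
        simp [P] at hx
        simp only [fpPal]
        omega
      intro j hjn hj _ _ hcx
      apply hxJ
      rw [Finset.mem_image]
      refine ⟨j, ?_, hcx⟩
      simp only [J, Finset.mem_union, Finset.mem_Icc]
      omega
  obtain ⟨x, hx1, hx2, hx3⟩ := hcol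
  have key : ∀ i, i ≠ p → (i ≤ k + 1 + (s + 1) ∨ n ≤ i + (k + 1 + s')) →
        (i ≤ k + 1 + s ∨ n ≤ i + (k + 1 + s')) := by intro i hi; omega
  refine ⟨fun i => if i = p then x else c i, ?_, ?_, ?_, ?_, ?_, ?_⟩
  · intro i hi h1
    by_cases hip : i = p
    · simpa [hip] using hx1
    · simpa [hip] using h.pal i hi (key i hip h1)
  · intro i j hij hj h1 h2 h3
    by_cases hip : i = p
    · have hjp : j ≠ p := by omega
      simp only [hip, hjp, if_true, if_false]
      exact (hx3 j hj (key j hjp h2) (by omega) (by omega)).symm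
    · by_cases hjp : j = p
      · simp only [hip, hjp, if_true, if_false]
        exact hx3 i (by omega) (key i hip h1) (by omega) (by omega)
      · simp only [hip, hjp, if_false]
        exact h.win i j hij hj (key i hip h1) (key j hjp h2) h3
  · intro i hi
    have hip : i ≠ p := by omega
    simpa [hip] using h.left i hi
  · intro i hi
    have hip : n - i ≠ p := by omega
    simpa [hip] using h.right i hi
  · intro i h1 h2 h3
    by_cases hip : i = p
    · left
      rw [if_pos (by omega)] at hx2
      simp only [hip, if_true]
      omega
    · simpa only [hip, if_false] using h.lvL i h1 h2 (key i hip h3)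
  · intro i h1 h2 h3
    by_cases hip : n - i = p
    · left
      rw [if_pos (by omega)] at hx2
      simp only [hip, if_true]
      omega
    · simpa only [hip, if_false] using h.lvR i h1 h2 (key _ hip h3)

theorem fp_greedy {k n d : ℕ} {gL gR : ℕ → ℕ × ℕ} {xL xR : ℕ × ℕ}
    (hk : 1 ≤ k) (hn : 2 * k + 3 ≤ n) (hd : 5 ≤ d)
    (hgL : ∀ i, i ≤ k → (gL i).2 ≤ i) (hgR : ∀ i, i ≤ k → (gR i).2 ≤ i)
    (h : ∃ c, FpGood k n d gL gR xL xR (fun i => i ≤ k + 1 + 1 ∨ n ≤ i + (k + 1 + 1)) c) :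
    ∃ c, FpGood k n d gL gR xL xR (fun _ => True) c := by
  have step : ∀ s, 1 ≤ s →
      ∃ c, FpGood k n d gL gR xL xR (fun i => i ≤ k + 1 + s ∨ n ≤ i + (k + 1 + s)) c := by
    intro s hs
    induction s, hs using Nat.le_induction with
    | base => exact h
    | succ s hs ih =>
      obtain ⟨c, hc⟩ := ih
      obtain ⟨c1, hc1⟩ := fp_extend hk hn hd hs (Or.inl rfl) hgL hgR hc
      have hc1' := hc1.flip (J := fun i => i ≤ k + 1 + s ∨ n ≤ i + (k + 1 + (s + 1)))
        (by omega) (by intro i hi; omega)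
      obtain ⟨c2, hc2⟩ := fp_extend hk hn hd hs (Or.inr rfl) hgR hgL hc1'
      exact ⟨_, hc2.flip (J := fun i => i ≤ k + 1 + (s + 1) ∨ n ≤ i + (k + 1 + (s + 1)))
        (by omega) (by intro i hi; omega)⟩
  obtain ⟨c, hc⟩ := step (n + 1) (by omega)
  exact ⟨c, fun i hi _ => hc.pal i hi (by omega),
      fun i j a b _ _ => hc.win i j a b (by omega) (by omega), hc.left, hc.right,
      fun i a b _ => hc.lvL i a b (by omega), fun i a b _ => hc.lvR i a b (by omega)⟩

theorem fpBall_pal {k d β p a i : ℕ} (hk : 1 ≤ k) (hβ : β = 1 ∨ β = 2) (hp : 1 ≤ p ∧ p ≤ d)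
    (ha : 1 ≤ a ∧ a ≤ d) (hi : i ≤ k + 1) : fpPal d k (fpBall k β p a i) := by
  unfold fpPal fpBall fpShift
  split_ifs <;> simp only [true_and] <;> omega

theorem fpBall_inj {k β p a i j : ℕ} (hk : 1 ≤ k) (hβ : β = 1 ∨ β = 2)
    (hij : i < j) (hj : j ≤ k + 1) : fpBall k β p a i ≠ fpBall k β p a j := by
  unfold fpBall fpShift
  split_ifs <;> simp only [ne_eq, Prod.mk.injEq] <;> omega

theorem fpBall_le {k β p a i : ℕ} (hi : i ≤ k) : (fpBall k β p a i).2 ≤ i := by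
  unfold fpBall fpShift
  split_ifs <;> simp only <;> omega

theorem fpBall_ge {k β p a i : ℕ} (hi : i ≤ k + 1) : i ≤ (fpBall k β p a i).2 + 1 := by
  unfold fpBall fpShift
  split_ifs <;> simp only <;> omega

theorem fpBall_cross {k β γ p q a b i j : ℕ} (hk : 1 ≤ k)
    (hab : a ≠ b) (hpq : p ≠ q) (hpb : p ≠ b) (hqa : q ≠ a)
    (hbad : p = a → q = b → β ≠ γ) (hβ : β = 1 ∨ β = 2) (hγ : γ = 1 ∨ γ = 2)
    (hi : i ≤ k + 1) (hj : j ≤ k + 1) (hij : 2 ≤ i + j) :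
    fpBall k β p a i ≠ fpBall k γ q b j := by
  unfold fpBall fpShift
  split_ifs <;> simp only [ne_eq, Prod.mk.injEq] <;> omega

theorem fpBall_top {k β p a e i : ℕ} (hk : 1 ≤ k) (hea : e ≠ a) (hep : e ≠ p) :
    fpBall k β p a i ≠ (e, k) := by
  unfold fpBall fpShift
  split_ifs <;> simp only [ne_eq, Prod.mk.injEq] <;> omega

theorem fp_base {k n d β γ p q a b : ℕ} {x y : ℕ × ℕ}
    (hk : 1 ≤ k) (hn : 2 * k + 3 ≤ n)
    (ha : 1 ≤ a ∧ a ≤ d) (hb : 1 ≤ b ∧ b ≤ d) (hp : 1 ≤ p ∧ p ≤ d) (hq : 1 ≤ q ∧ q ≤ d)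
    (hab : a ≠ b) (hpq : p ≠ q) (hpb : p ≠ b) (hqa : q ≠ a)
    (hbad : p = a → q = b → β ≠ γ) (hβ : β = 1 ∨ β = 2) (hγ : γ = 1 ∨ γ = 2)
    (hx : fpPal d k x) (hxk : x.2 = k)
    (hxL : ∀ i, i ≤ k + 1 → fpBall k β p a i ≠ x) (hxR : ∀ i, i ≤ k + 1 → fpBall k γ q b i ≠ x)
    (hy : fpPal d k y) (hyk : y.2 = k ∨ (y.2 + 1 = k ∧ y = fpShift γ b k)) (hxy : x ≠ y)
    (hyL : ∀ i, 1 ≤ i ∨ 2 ≤ k → i ≤ k + 1 → fpBall k β p a i ≠ y)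
    (hyR : ∀ i, i ≤ k + 1 → fpBall k γ q b i ≠ y) :
    ∃ c, FpGood k n d (fpBall k β p a) (fpBall k γ q b) (fpShift β a k) (fpShift γ b k)
      (fun i => i ≤ k + 1 + 1 ∨ n ≤ i + (k + 1 + 1)) c := by
  refine ⟨fun i => if i ≤ k + 1 then fpBall k β p a i else if n ≤ i + (k + 1) then
    fpBall k γ q b (n - i) else if i = k + 2 then x else y, ?_, ?_, ?_, ?_, ?_, ?_⟩
  · intro i hi _
    split_ifs
    · exact fpBall_pal hk hβ hp ha (by omega)
    · exact fpBall_pal hk hγ hq hb (by omega)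
    · exact hx
    · exact hy
  · intro i j hij hj h1 h2 h3
    split_ifs <;> try omega
    · exact fpBall_inj hk hβ hij (by omega)
    · exact fpBall_cross hk hab hpq hpb hqa hbad hβ hγ (by omega) (by omega) (by omega)
    · exact hxL i (by omega)
    · exact hyL i (by omega) (by omega)
    · exact (fpBall_inj hk hγ (by omega) (by omega)).symm
    · exact (hxR _ (by omega)).symm
    · exact (hyR _ (by omega)).symm
  · intro i hi
    simp [hi]
  · intro i hi
    have h1 : ¬ (n - i ≤ k + 1) := by omega
    have h2 : n ≤ n - i + (k + 1) := by omega
    have h3 : n - (n - i) = i := by omega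
    simp only [h1, h2, h3, if_true, if_false]
  · intro i h1 h2 h3
    left
    split_ifs <;> try omega
    have := fpBall_ge (k := k) (β := γ) (p := q) (a := b) (i := n - i) (by omega)
    omega
  · intro i h1 h2 h3
    split_ifs
    · have := fpBall_ge (k := k) (β := β) (p := p) (a := a) (i := n - i) (by omega)
      omega
    · omega
    · omega
    · rcases hyk with hyk | ⟨hyk, hyk'⟩
      · omega
      · right
        exact ⟨by omega, hyk'⟩

theorem fp_seq {k n d β γ p q a b : ℕ}
    (hk : 1 ≤ k) (hn : 2 * k + 3 ≤ n) (hd : 5 ≤ d)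
    (ha : 1 ≤ a ∧ a ≤ d) (hb : 1 ≤ b ∧ b ≤ d) (hp : 1 ≤ p ∧ p ≤ d) (hq : 1 ≤ q ∧ q ≤ d)
    (hab : a ≠ b) (hpq : p ≠ q) (hpb : p ≠ b) (hqa : q ≠ a)
    (hbad : p = a → q = b → β ≠ γ) (hβ : β = 1 ∨ β = 2) (hγ : γ = 1 ∨ γ = 2) :
    ∃ c, FpGood k n d (fpBall k β p a) (fpBall k γ q b) (fpShift β a k) (fpShift γ b k)
      (fun _ => True) c := by
  apply fp_greedy hk hn hd (fun i => fpBall_le) (fun i => fpBall_le)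
  by_cases hc : p = a ∨ q = b
  · have h2 : ∃ S : Finset ℕ, S.card ≤ 3 ∧ a ∈ S ∧ b ∈ S ∧ p ∈ S ∧ q ∈ S := by
      rcases hc with h | h
      · exact ⟨{a, b, q}, Finset.card_le_three, by simp [h]⟩
      · exact ⟨{a, b, p}, Finset.card_le_three, by simp [h]⟩
    obtain ⟨S, hS, h1, h2, h3, h4⟩ := h2
    have hcard : (Finset.Icc 1 d).card = d := by simp
    obtain ⟨e, he, heS⟩ := Finset.exists_mem_notMem_of_card_lt_card
      (s := S) (t := Finset.Icc 1 d) (by omega)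
    have := Finset.card_insert_le e S
    obtain ⟨e', he', heS'⟩ := Finset.exists_mem_notMem_of_card_lt_card
      (s := insert e S) (t := Finset.Icc 1 d) (by omega)
    rw [Finset.mem_Icc] at he he'
    rw [Finset.mem_insert, not_or] at heS'
    have hne : ∀ {z w : ℕ}, z ∈ S → w ∉ S → w ≠ z := by
      rintro z w hz hw rfl
      exact hw hz
    exact fp_base (x := (e, k)) (y := (e', k)) hk hn ha hb hp hq hab hpq hpb hqa hbad hβ hγ
      (Or.inr (by simp only; omega)) rfl
      (fun i _ => fpBall_top hk (hne h1 heS) (hne h3 heS))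
      (fun i _ => fpBall_top hk (hne h2 heS) (hne h4 heS))
      (Or.inr (by simp only; omega)) (Or.inl rfl)
      (by simp only [ne_eq, Prod.mk.injEq]; have := heS'.1; omega)
      (fun i _ _ => fpBall_top hk (hne h1 heS'.2) (hne h3 heS'.2))
      (fun i _ => fpBall_top hk (hne h2 heS'.2) (hne h4 heS'.2))
  · rw [not_or] at hc
    have hcard : (Finset.Icc 1 d).card = d := by simp
    have hS : ({a, b, p, q} : Finset ℕ).card ≤ 4 := Finset.card_le_four
    obtain ⟨e, he, heS⟩ := Finset.exists_mem_notMem_of_card_lt_card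
      (s := {a, b, p, q}) (t := Finset.Icc 1 d) (by omega)
    rw [Finset.mem_Icc] at he
    simp only [Finset.mem_insert, Finset.mem_singleton, not_or] at heS
    obtain ⟨h1, h2, h3, h4⟩ := heS
    obtain ⟨hc1, hc2⟩ := hc
    refine fp_base (x := (e, k)) (y := fpShift γ b k) hk hn ha hb hp hq hab hpq hpb hqa hbad hβ hγ
      (Or.inr (by simp only; omega)) rfl
      (fun i _ => fpBall_top hk h1 h3)
      (fun i _ => fpBall_top hk h2 h4) ?_ (Or.inr ⟨?_, rfl⟩) ?_ ?_ ?_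
    · unfold fpPal fpShift
      split_ifs <;> simp only [true_and] <;> omega
    · unfold fpShift
      split_ifs <;> simp only <;> omega
    · unfold fpShift
      split_ifs <;> simp only [ne_eq, Prod.mk.injEq] <;> omega
    · intro i hi1 hi2
      unfold fpBall fpShift
      split_ifs <;> simp only [ne_eq, Prod.mk.injEq] <;> omega
    · intro i hi2
      unfold fpBall fpShift
      split_ifs <;> simp only [ne_eq, Prod.mk.injEq] <;> omega

section FpGraph

variable {V : Type*} {G : SimpleGraph V} {n : ℕ}

theorem fp_flip {u v : V} (h : G.Adj u v) (i : ℕ) (hi : i ≤ n) :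
    mkVert G n h i hi = mkVert G n h.symm (n - i) (Nat.sub_le n i) :=
  Quot.sound (SubdivRel.flip u v i h hi)

theorem fp_zero {u v : V} (h : G.Adj u v) :
    mkVert G n h 0 (Nat.zero_le n) = branchVertex G n u :=
  Quot.sound (SubdivRel.collapse u v h)

theorem fp_full {u v : V} (h : G.Adj u v) :
    mkVert G n h n le_rfl = branchVertex G n v := by
  rw [fp_flip, ← fp_zero h.symm]
  simp

/-- Extending compatible edge functions to the subdivision. -/
theorem fp_lift {α : Type*} (B : V → α) (S : V → V → ℕ → α)
    (h0 : ∀ u v, G.Adj u v → S u v 0 = B u)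
    (hf : ∀ u v i, G.Adj u v → i ≤ n → S v u (n - i) = S u v i) :
    ∃ C : SubdivVert G n → α, (∀ u, C (branchVertex G n u) = B u) ∧
      ∀ u v (h : G.Adj u v) i (hi : i ≤ n), C (mkVert G n h i hi) = S u v i := by
  classical
  refine ⟨Quot.lift (fun p => if p.1.1 = p.1.2.1 then B p.1.1 else S p.1.1 p.1.2.1 p.1.2.2) ?_,
    ?_, ?_⟩
  · intro p q hpq
    cases hpq with
    | flip u v i h hi => simp [h.ne, h.ne.symm, hf u v i h hi]
    | collapse u v h => simp [h.ne, h0 u v h]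
  · intro u
    simp [branchVertex]
  · intro u v h i hi
    simp [mkVert, h.ne]

theorem fp_eq (hn : 0 < n) {u v a b : V} (h : G.Adj u v) (h' : G.Adj a b) {i j : ℕ} (hi : i ≤ n)
    (hj : j ≤ n) (e : mkVert G n h i hi = mkVert G n h' j hj) :
    (if i = 0 then {(u, u, 0)} else if i = n then {(v, v, 0)} else
      {(u, v, i), (v, u, n - i)} : Set (V × V × ℕ)) =
    (if j = 0 then {(a, a, 0)} else if j = n then {(b, b, 0)} else
      {(a, b, j), (b, a, n - j)} : Set (V × V × ℕ)) := by
  obtain ⟨C, -, hC⟩ := fp_lift (G := G) (n := n) (fun u => ({(u, u, 0)} : Set (V × V × ℕ)))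
    (fun u v i => (if i = 0 then {(u, u, 0)} else if i = n then {(v, v, 0)} else
      {(u, v, i), (v, u, n - i)} : Set (V × V × ℕ))) (by simp) (by
      intro u v i _ hi
      have h1 : n - (n - i) = i := by omega
      rw [h1]
      split_ifs <;> first | omega | rfl | exact Set.pair_comm _ _)
  have := congrArg C e
  rwa [hC, hC] at this

theorem fp_eq_zero (hn : 0 < n) {u v a : V} (h : G.Adj u v) {i : ℕ} (hi : i ≤ n)
    (e : mkVert G n h i hi = branchVertex G n a) :
    (i = 0 ∧ u = a) ∨ (i = n ∧ v = a) := by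
  obtain ⟨C, hB, hC⟩ := fp_lift (G := G) (n := n) (fun u => ({(u, u, 0)} : Set (V × V × ℕ)))
    (fun u v i => (if i = 0 then {(u, u, 0)} else if i = n then {(v, v, 0)} else
      {(u, v, i), (v, u, n - i)} : Set (V × V × ℕ))) (by simp) (by
      intro u v i _ hi
      have h1 : n - (n - i) = i := by omega
      rw [h1]
      split_ifs <;> first | omega | rfl | exact Set.pair_comm _ _)
  have := congrArg C e
  rw [hC, hB] at this
  split_ifs at this with h1 h2
  · left; simpa [h1] using this
  · right; simpa [h2] using this
  · have h3 : (u, v, i) ∈ ({(a, a, 0)} : Set (V × V × ℕ)) := by rw [← this]; simp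
    simp at h3
    omega

theorem fp_eq_inner {u v a b : V} (h : G.Adj u v) (h' : G.Adj a b) {i j : ℕ} (hi : i ≤ n)
    (hj0 : 0 < j) (hj : j < n) (e : mkVert G n h i hi = mkVert G n h' j hj.le) :
    (u = a ∧ v = b ∧ i = j) ∨ (u = b ∧ v = a ∧ i = n - j) := by
  have := fp_eq (by omega) h h' hi hj.le e
  rw [if_neg (by omega : ¬ j = 0), if_neg (by omega : ¬ j = n)] at this
  have h1 : (a, b, j) ∈ ({(a, b, j), (b, a, n - j)} : Set (V × V × ℕ)) := by simp
  rw [← this] at h1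
  split_ifs at h1
  · simp at h1
    omega
  · simp at h1
    omega
  · simp at h1
    rcases h1 with ⟨h1, h2, h3⟩ | ⟨h1, h2, h3⟩
    · exact Or.inl ⟨h1.symm, h2.symm, h3.symm⟩
    · exact Or.inr ⟨h2.symm, h1.symm, by omega⟩

theorem fp_adj {X Y : SubdivVert G n} (h : (subdivision G n).Adj X Y) :
    ∃ (u v : V) (h : G.Adj u v) (i : ℕ) (hi : i < n),
      X = mkVert G n h i hi.le ∧ Y = mkVert G n h (i + 1) hi := by
  rw [subdivision, SimpleGraph.fromRel_adj] at h
  rcases h.2 with h1 | ⟨u, v, h1, i, hi, rfl, rfl⟩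
  · exact h1
  · refine ⟨v, u, h1.symm, n - (i + 1), by omega, fp_flip _ _ _, ?_⟩
    rw [fp_flip]
    congr 1
    omega

/-- Structure of short walks in the subdivision. -/
theorem fp_walk {X Y : SubdivVert G n} (w : (subdivision G n).Walk X Y) (hw : w.length < n) :
    X = Y ∨
    (∃ (u v : V) (h : G.Adj u v) (i j : ℕ) (hi : i ≤ n) (hj : j ≤ n), i ≤ j + w.length ∧
      j ≤ i + w.length ∧ X = mkVert G n h i hi ∧ Y = mkVert G n h j hj) ∨
    (∃ (u v v' : V) (h : G.Adj u v) (h' : G.Adj u v') (i j : ℕ) (hi : i ≤ n) (hj : j ≤ n),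
      i + j ≤ w.length ∧ X = mkVert G n h i hi ∧ Y = mkVert G n h' j hj) := by
  induction w with
  | nil => exact Or.inl rfl
  | @cons X' X Y hadj w ih =>
    rw [SimpleGraph.Walk.length_cons] at hw ⊢
    obtain ⟨a, b, hab, p, hp, hX, hX'⟩ := fp_adj hadj.symm
    subst hX hX'
    rcases ih (by omega) with rfl | ⟨u, v, h, i, j, hi, hj, h1, h2, h3, h4⟩ |
      ⟨u, v, v', h, h', i, j, hi, hj, h1, h3, h4⟩
    · exact Or.inr (Or.inl ⟨a, b, hab, p + 1, p, by omega, by omega, by omega, by omega, rfl, rfl⟩)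
    · by_cases hp0 : p = 0
      · subst hp0
        rw [fp_zero] at h3
        rcases fp_eq_zero (by omega) h hi h3.symm with ⟨rfl, rfl⟩ | ⟨rfl, rfl⟩
        · exact Or.inr (Or.inr ⟨_, b, v, hab, h, 1, j, by omega, hj, by omega, rfl, h4⟩)
        · refine Or.inr (Or.inr ⟨_, b, u, hab, h.symm, 1, i - j, by omega, by omega, by omega,
            rfl, ?_⟩)
          exact h4.trans (fp_flip _ _ _)
      · rcases fp_eq_inner h hab hi (by omega) hp h3.symm with ⟨rfl, rfl, rfl⟩ | ⟨rfl, rfl, rfl⟩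
        · exact Or.inr (Or.inl ⟨_, _, h, i + 1, j, by omega, hj, by omega, by omega, rfl, h4⟩)
        · refine Or.inr (Or.inl ⟨_, _, hab, p + 1, n - j, by omega, by omega, by omega, by omega,
            rfl, ?_⟩)
          exact h4.trans (fp_flip _ _ _)
    · by_cases hp0 : p = 0
      · subst hp0
        rw [fp_zero] at h3
        rcases fp_eq_zero (by omega) h hi h3.symm with ⟨rfl, rfl⟩ | ⟨rfl, rfl⟩
        · exact Or.inr (Or.inr ⟨_, b, v', hab, h', 1, j, by omega, hj, by omega, rfl, h4⟩)
        · omega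
      · rcases fp_eq_inner h hab hi (by omega) hp h3.symm with ⟨rfl, rfl, rfl⟩ | ⟨rfl, rfl, rfl⟩
        · exact Or.inr (Or.inr ⟨_, _, _, h, h', i + 1, j, by omega, hj, by omega, rfl, h4⟩)
        · refine Or.inr (Or.inr ⟨_, _, _, h, h', n - (p + 1), j, by omega, by omega, by omega,
            ?_, h4⟩)
          rw [fp_flip]

theorem fp_colorable {k d : ℕ} (hn : 2 * k + 2 ≤ n) (B : V → ℕ × ℕ) (S : V → V → ℕ → ℕ × ℕ)
    (h0 : ∀ u v, G.Adj u v → S u v 0 = B u)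
    (hf : ∀ u v i, G.Adj u v → i ≤ n → S v u (n - i) = S u v i)
    (hBp : ∀ u, fpPal d k (B u))
    (hSp : ∀ u v i, G.Adj u v → i ≤ n → fpPal d k (S u v i))
    (hwin : ∀ u v i j, G.Adj u v → i < j → j ≤ n → j ≤ i + (2 * k + 1) → S u v i ≠ S u v j)
    (hstar : ∀ u v w i j, G.Adj u v → G.Adj u w → v ≠ w → 1 ≤ i → 1 ≤ j → j ≤ k →
      i + j ≤ 2 * k + 1 → S u v i ≠ S u w j) :
    (fracPower G (2 * k + 1) n).Colorable (d * k + 2) := by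
  classical
  obtain ⟨C, hCB, hCS⟩ := fp_lift (n := n) B S h0 hf
  have hCp : ∀ X, fpPal d k (C X) := by
    intro X
    induction X using Quot.ind with
    | mk p =>
      obtain ⟨⟨u, v, i⟩, hp⟩ := p
      rcases hp with ⟨h1, h2⟩ | ⟨h1, h2⟩
      · simp only at h1 h2
        subst h1 h2
        have := hBp u
        rw [← hCB] at this
        exact this
      · have := hSp u v i h1 h2
        rw [← hCS u v h1 i h2] at this
        exact this
  have hstar' : ∀ u v w i j, G.Adj u v → G.Adj u w → v ≠ w → 1 ≤ i → 1 ≤ j →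
      i + j ≤ 2 * k + 1 → S u v i ≠ S u w j := by
    intro u v w i j h1 h2 h3 h4 h5 h6
    by_cases hj : j ≤ k
    · exact hstar u v w i j h1 h2 h3 h4 h5 hj h6
    · exact (hstar u w v j i h2 h1 h3.symm h5 h4 (by omega) (by omega)).symm
  have hwin' : ∀ u v i j, G.Adj u v → i ≤ n → j ≤ n → i ≠ j → j ≤ i + (2 * k + 1) →
      i ≤ j + (2 * k + 1) → S u v i ≠ S u v j := by
    intro u v i j h hi hj hij h1 h2
    rcases Nat.lt_or_gt_of_ne hij with h3 | h3
    · exact hwin u v i j h h3 hj h1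
    · exact (hwin u v j i h h3 hi h2).symm
  have hmain : ∀ X Y, X ≠ Y → (∃ w : (subdivision G n).Walk X Y, w.length ≤ 2 * k + 1) →
      C X ≠ C Y := by
    rintro X Y hXY ⟨w, hw⟩
    rcases fp_walk w (by omega) with h | ⟨u, v, h, i, j, hi, hj, h1, h2, h3, h4⟩ |
      ⟨u, v, v', h, h', i, j, hi, hj, h1, h3, h4⟩
    · exact absurd h hXY
    · subst h3 h4
      rw [hCS, hCS]
      refine hwin' u v i j h hi hj ?_ (by omega) (by omega)
      rintro rfl
      exact hXY rfl
    · subst h3 h4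
      rw [hCS, hCS]
      by_cases hvv : v = v'
      · subst hvv
        refine hwin' u v i j h hi hj ?_ (by omega) (by omega)
        rintro rfl
        exact hXY rfl
      · by_cases hi0 : i = 0
        · subst hi0
          rw [h0 u v h, ← h0 u v' h']
          refine hwin' u v' 0 j h' hi hj ?_ (by omega) (by omega)
          rintro rfl
          rw [fp_zero, fp_zero] at hXY
          exact hXY rfl
        · by_cases hj0 : j = 0
          · subst hj0
            rw [h0 u v' h', ← h0 u v h]
            exact hwin' u v i 0 h hi hj hi0 (by omega) (by omega)
          · exact hstar' u v v' i j h h' hvv (by omega) (by omega) (by omega)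
  let P : Finset (ℕ × ℕ) := (Finset.Icc 1 d ×ˢ Finset.Icc 1 k) ∪ {(1, 0), (2, 0)}
  have hP : P.card = d * k + 2 := by
    simp only [P]
    rw [Finset.card_union_of_disjoint]
    · simp
    · rw [Finset.disjoint_left]
      rintro ⟨a, b⟩ hab
      simp at hab ⊢
      omega
  have hmem : ∀ X, C X ∈ P := by
    intro X
    have := hCp X
    generalize C X = x at this ⊢
    obtain ⟨x1, x2⟩ := x
    simp only [fpPal] at this
    simp [P]
    omega
  let col : (fracPower G (2 * k + 1) n).Coloring P := SimpleGraph.Coloring.mk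
    (fun X => ⟨C X, hmem X⟩) (by
      intro X Y hXY e
      rw [fracPower, powerGraph, SimpleGraph.fromRel_adj] at hXY
      have e' : C X = C Y := congrArg Subtype.val e
      rcases hXY.2 with h | h
      · exact hmain X Y hXY.1 h e'
      · exact hmain Y X hXY.1.symm h e'.symm)
  have := col.colorable
  rwa [Fintype.card_coe, hP] at this

theorem fp_adj_mk {u v : V} (h : G.Adj u v) (i : ℕ) (hi : i < n) :
    (subdivision G n).Adj (mkVert G n h i hi.le) (mkVert G n h (i + 1) hi) := by
  rw [subdivision, SimpleGraph.fromRel_adj]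
  refine ⟨?_, Or.inl ⟨u, v, h, i, hi, rfl, rfl⟩⟩
  intro e
  by_cases hi0 : i = 0
  · subst hi0
    rw [fp_zero] at e
    rcases fp_eq_zero (by omega) h _ e.symm with ⟨h1, -⟩ | ⟨-, h1⟩
    · omega
    · exact h.ne h1.symm
  · rcases fp_eq_inner h h _ (by omega) hi e.symm with ⟨-, -, h1⟩ | ⟨h1, -, -⟩
    · omega
    · exact h.ne h1

theorem fp_walk_mk {u v : V} (h : G.Adj u v) (i : ℕ) (hi : i ≤ n) :
    ∃ w : (subdivision G n).Walk (branchVertex G n u) (mkVert G n h i hi), w.length = i := by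
  induction i with
  | zero =>
    rw [fp_zero]
    exact ⟨SimpleGraph.Walk.nil, rfl⟩
  | succ i ih =>
    obtain ⟨w, hw⟩ := ih (by omega)
    exact ⟨w.concat (fp_adj_mk h i hi), by simp [hw]⟩

theorem fp_finite [Finite V] : Finite (SubdivVert G n) := by
  have : Finite (SubdivPre G n) := by
    have hfin : Set.Finite {p : V × V × ℕ | p.2.2 ≤ n} := by
      have : {p : V × V × ℕ | p.2.2 ≤ n} =
          (Set.univ : Set V) ×ˢ ((Set.univ : Set V) ×ˢ Set.Iic n) := by
        ext ⟨a, b, i⟩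
        simp
      rw [this]
      exact Set.finite_univ.prod (Set.finite_univ.prod (Set.finite_Iic n))
    refine Set.Finite.to_subtype (hfin.subset ?_)
    rintro ⟨a, b, i⟩ (⟨h1, h2⟩ | ⟨h1, h2⟩)
    · simp only at h2
      simp [h2]
    · exact h2
  exact Finite.of_surjective (Quot.mk _) Quot.mk_surjective

theorem fp_clique [Fintype V] [DecidableRel G.Adj] {k : ℕ} (hn : 2 * k + 2 ≤ n) (u : V)
    (hu : 0 < G.degree u) :
    G.degree u * k + 2 ≤ (fracPower G (2 * k + 1) n).cliqueNum := by
  classical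
  have := fp_finite (G := G) (n := n)
  obtain ⟨v0, hv0⟩ := (G.degree_pos_iff_exists_adj u).1 hu
  let Q : Finset (V × ℕ) := (G.neighborFinset u ×ˢ Finset.Icc 1 k) ∪ {(v0, 0), (v0, k + 1)}
  have hQ : Q.card = G.degree u * k + 2 := by
    simp only [Q]
    rw [Finset.card_union_of_disjoint]
    · simp
    · rw [Finset.disjoint_left]
      rintro ⟨a, b⟩ hab
      simp at hab ⊢
      omega
  have hQadj : ∀ q ∈ Q, G.Adj u q.1 := by
    rintro ⟨a, b⟩ hq
    simp [Q] at hq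
    rcases hq with h | h | h
    · rw [h.1]; exact hv0
    · rw [h.1]; exact hv0
    · exact h.1
  have hQle : ∀ q ∈ Q, q.2 ≤ k + 1 := by
    rintro ⟨a, b⟩ hq
    simp [Q] at hq ⊢
    omega
  have hQ0 : ∀ q ∈ Q, q.2 = 0 → q = (v0, 0) := by
    rintro ⟨a, b⟩ hq h0
    simp [Q] at hq h0 ⊢
    rcases hq with h | h | h
    · exact h
    · omega
    · omega
  have hQt : ∀ q ∈ Q, q.2 = k + 1 → q = (v0, k + 1) := by
    rintro ⟨a, b⟩ hq h0
    simp [Q] at hq h0 ⊢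
    rcases hq with h | h | h
    · omega
    · exact h
    · omega
  let φ : V × ℕ → SubdivVert G n := fun q =>
    if h : G.Adj u q.1 ∧ q.2 ≤ n then mkVert G n h.1 q.2 h.2 else branchVertex G n u
  have hφ : ∀ q ∈ Q, ∃ (h1 : G.Adj u q.1) (h2 : q.2 ≤ n), φ q = mkVert G n h1 q.2 h2 := by
    intro q hq
    have h1 := hQadj q hq
    have h2 := hQle q hq
    have h3 : G.Adj u q.1 ∧ q.2 ≤ n := ⟨h1, by omega⟩
    exact ⟨h1, h3.2, by simp only [φ, h3, and_self, dif_pos]⟩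
  have hinj : Set.InjOn φ Q := by
    intro q hq q' hq' e
    rw [Finset.mem_coe] at hq hq'
    obtain ⟨h1, h2, h3⟩ := hφ q hq
    obtain ⟨h1', h2', h3'⟩ := hφ q' hq'
    rw [h3, h3'] at e
    have hle := hQle q hq
    have hle' := hQle q' hq'
    by_cases h0 : q'.2 = 0
    · have : mkVert G n h1' q'.2 h2' = branchVertex G n u := by
        rw [← fp_zero h1']
        congr 1
      rw [this] at e
      rcases fp_eq_zero (by omega) h1 h2 e with ⟨h4, -⟩ | ⟨-, h4⟩
      · rw [hQ0 q hq h4, hQ0 q' hq' h0]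
      · exact absurd h4.symm h1.ne
    · rcases fp_eq_inner h1 h1' h2 (by omega) (by omega) e with ⟨-, h4, h5⟩ | ⟨h4, -, -⟩
      · exact Prod.ext h4 h5
      · exact absurd h4 h1'.ne
  have hcl : (fracPower G (2 * k + 1) n).IsClique (Q.image φ : Finset (SubdivVert G n)) := by
    intro X hX Y hY hXY
    rw [Finset.mem_coe, Finset.mem_image] at hX hY
    obtain ⟨q, hq, rfl⟩ := hX
    obtain ⟨q', hq', rfl⟩ := hY
    rw [fracPower, powerGraph, SimpleGraph.fromRel_adj]
    refine ⟨hXY, Or.inl ?_⟩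
    have hqq : q ≠ q' := by
      rintro rfl
      exact hXY rfl
    have hle := hQle q hq
    have hle' := hQle q' hq'
    have hsum : q.2 + q'.2 ≤ 2 * k + 1 := by
      by_contra hcon
      apply hqq
      rw [hQt q hq (by omega), hQt q' hq' (by omega)]
    obtain ⟨h1, h2, h3⟩ := hφ q hq
    obtain ⟨h1', h2', h3'⟩ := hφ q' hq'
    rw [h3, h3']
    obtain ⟨w, hw⟩ := fp_walk_mk h1 q.2 h2
    obtain ⟨w', hw'⟩ := fp_walk_mk h1' q'.2 h2'
    refine ⟨w.reverse.append w', ?_⟩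
    rw [SimpleGraph.Walk.length_append, SimpleGraph.Walk.length_reverse]
    omega
  have := hcl.card_le_cliqueNum
  rwa [Finset.card_image_of_injOn hinj, hQ] at this

theorem fp_half_mem {u v : V} (h : G.Adj u v) : halfEdge G h ∈ (subdivision G 2).edgeSet := by
  rw [halfEdge, SimpleGraph.mem_edgeSet, ← fp_zero h]
  exact fp_adj_mk h 0 (by omega)

theorem fp_half_ne {u v w : V} (h : G.Adj u v) (h' : G.Adj u w) (hvw : v ≠ w) :
    halfEdge G h ≠ halfEdge G h' := by
  intro e
  rw [halfEdge, halfEdge, Sym2.eq_iff] at e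
  rcases e with ⟨-, e⟩ | ⟨e, -⟩
  · rcases fp_eq_inner h h' _ (by omega) (by omega) e with ⟨-, h1, -⟩ | ⟨h1, -, -⟩
    · exact hvw h1
    · exact h'.ne h1
  · rcases fp_eq_zero (by omega) h' _ e.symm with ⟨h1, -⟩ | ⟨h1, -⟩ <;> omega

theorem fp_half_ne' {u v : V} (h : G.Adj u v) : halfEdge G h ≠ halfEdge G h.symm := by
  intro e
  rw [halfEdge, halfEdge, Sym2.eq_iff] at e
  rcases e with ⟨e, -⟩ | ⟨e, -⟩
  · rw [← fp_zero h] at e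
    rcases fp_eq_zero (by omega) h _ e with ⟨-, h1⟩ | ⟨h1, -⟩
    · exact h.ne h1
    · omega
  · rcases fp_eq_zero (by omega) h.symm _ e.symm with ⟨h1, -⟩ | ⟨h1, -⟩ <;> omega

end FpGraph

theorem fpBall_star {k β p p' a i j : ℕ} (hk : 1 ≤ k) (hpp : p ≠ p')
    (hi1 : 1 ≤ i) (hi : i ≤ k + 1) (hj1 : 1 ≤ j) (hj : j ≤ k) :
    fpBall k β p a i ≠ fpBall k β p' a j := by
  unfold fpBall fpShift
  split_ifs <;> simp only [ne_eq, Prod.mk.injEq] <;> omega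

theorem fpBall_ne_shift {k β p a j : ℕ} (hj1 : 1 ≤ j) (hj : j + 1 ≤ k) :
    fpShift β a k ≠ fpBall k β p a j := by
  unfold fpBall fpShift
  split_ifs <;> simp only [ne_eq, Prod.mk.injEq] <;> omega

section FpMain

variable {V : Type*} {G : SimpleGraph V} {n k d : ℕ}

/-- The case `n = m + 1`. -/
theorem fp_color_tight (hk : 1 ≤ k) (p : V → V → ℕ)
    (hp : ∀ u v, G.Adj u v → 1 ≤ p u v ∧ p u v ≤ d)
    (hpv : ∀ u v w, G.Adj u v → G.Adj u w → v ≠ w → p u v ≠ p u w)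
    (hpe : ∀ u v, G.Adj u v → p u v ≠ p v u) :
    (fracPower G (2 * k + 1) (2 * k + 2)).Colorable (d * k + 2) := by
  refine fp_colorable (le_refl _) (fun _ => (1, 0))
    (fun u v i => if i = 0 ∨ i = 2 * k + 2 then (1, 0) else if i = k + 1 then (2, 0) else
      if i ≤ k then (p u v, i) else (p v u, 2 * k + 2 - i)) ?_ ?_ ?_ ?_ ?_ ?_
  · intro u v _
    simp
  · intro u v i _ hi
    split_ifs <;> simp only [Prod.mk.injEq, true_and, and_true] <;> omega
  · intro u
    left
    simp
  · intro u v i h hi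
    have h1 := hp u v h
    have h2 := hp v u h.symm
    unfold fpPal
    split_ifs <;> simp only [true_and, true_or, or_true] <;> omega
  · intro u v i j h hij hj hw
    have h1 := hpe u v h
    split_ifs <;> simp only [ne_eq, Prod.mk.injEq] <;> omega
  · intro u v w i j h h' hvw hi hj hjk hij
    have h1 := hpv u v w h h' hvw
    split_ifs <;> simp only [ne_eq, Prod.mk.injEq] <;> omega

/-- The case `n ≥ m + 2`. -/
theorem fp_color_loose (hk : 1 ≤ k) (hn : 2 * k + 3 ≤ n) (hd : 5 ≤ d) (f : V → ℕ) (p : V → V → ℕ)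
    (hf : ∀ v, 1 ≤ f v ∧ f v ≤ d) (hfe : ∀ u v, G.Adj u v → f u ≠ f v)
    (hp : ∀ u v, G.Adj u v → 1 ≤ p u v ∧ p u v ≤ d)
    (hpv : ∀ u v w, G.Adj u v → G.Adj u w → v ≠ w → p u v ≠ p u w)
    (hpe : ∀ u v, G.Adj u v → p u v ≠ p v u)
    (hpf : ∀ u v, G.Adj u v → p u v ≠ f v) :
    (fracPower G (2 * k + 1) n).Colorable (d * k + 2) := by
  classical
  obtain ⟨b, hb⟩ : ∃ b : V → ℕ, b = fun u =>
    if ∃ v, G.Adj u v ∧ p u v = f u ∧ p v u = f v ∧ f v < f u then 2 else 1 := ⟨_, rfl⟩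
  have hb12 : ∀ u, b u = 1 ∨ b u = 2 := by
    intro u
    rw [hb]
    beta_reduce
    split_ifs <;> simp
  have hbval : ∀ u v, G.Adj u v → p u v = f u → p v u = f v → (b u = 2 ↔ f v < f u) := by
    intro u v h h1 h2
    rw [hb]
    beta_reduce
    split_ifs with hc
    · obtain ⟨w, hw, h3, h4, h5⟩ := hc
      have : v = w := by
        by_contra hne
        exact hpv u v w h hw hne (h1.trans h3.symm)
      subst this
      simp [h5]
    · simp only [OfNat.one_ne_ofNat, false_iff]
      intro h5
      exact hc ⟨v, h, h1, h2, h5⟩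
  have hbbad : ∀ u v, G.Adj u v → p u v = f u → p v u = f v → b u ≠ b v := by
    intro u v h h1 h2 h3
    have h4 := hbval u v h h1 h2
    have h5 := hbval v u h.symm h2 h1
    have := hfe u v h
    rw [h3] at h4
    omega
  have hex : ∀ u v, ∃ c, G.Adj u v → FpGood k n d (fpBall k (b u) (p u v) (f u))
      (fpBall k (b v) (p v u) (f v)) (fpShift (b u) (f u) k) (fpShift (b v) (f v) k)
      (fun _ => True) c := by
    intro u v
    by_cases h : G.Adj u v
    · obtain ⟨c, hc⟩ := fp_seq hk hn hd (hf u) (hf v) (hp u v h) (hp v u h.symm) (hfe u v h)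
        (hpe u v h) (hpf u v h) (hpf v u h.symm) (hbbad u v h) (hb12 u) (hb12 v)
      exact ⟨c, fun _ => hc⟩
    · exact ⟨fun _ => 0, fun h' => absurd h' h⟩
  choose C hC using hex
  obtain ⟨S, hS⟩ : ∃ S : V → V → ℕ → ℕ × ℕ, S = fun u v i =>
    if f u < f v then C u v i else C v u (n - i) := ⟨_, rfl⟩
  have hSG : ∀ u v, G.Adj u v → FpGood k n d (fpBall k (b u) (p u v) (f u))
      (fpBall k (b v) (p v u) (f v)) (fpShift (b u) (f u) k) (fpShift (b v) (f v) k)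
      (fun _ => True) (S u v) := by
    intro u v h
    by_cases hlt : f u < f v
    · have : S u v = C u v := by
        rw [hS]
        funext i
        simp [hlt]
      rw [this]
      exact hC u v h
    · have : S u v = fun i => C v u (n - i) := by
        rw [hS]
        funext i
        simp [hlt]
      rw [this]
      exact (hC v u h.symm).flip (by omega) (fun _ _ _ => trivial)
  have hSf : ∀ u v i, G.Adj u v → i ≤ n → S v u (n - i) = S u v i := by
    intro u v i h hi
    have hne := hfe u v h
    rw [hS]
    beta_reduce
    by_cases hlt : f u < f v
    · rw [if_neg (by omega), if_pos hlt]
      congr 1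
      omega
    · rw [if_pos (by omega), if_neg hlt]
  refine fp_colorable (by omega) (fun u => (b u, 0)) S ?_ hSf ?_ ?_ ?_ ?_
  · intro u v h
    rw [(hSG u v h).left 0 (by omega)]
    simp [fpBall]
  · intro u
    exact Or.inl ⟨rfl, hb12 u⟩
  · intro u v i h hi
    exact (hSG u v h).pal i hi trivial
  · intro u v i j h hij hj hw
    exact (hSG u v h).win i j hij hj trivial trivial hw
  · intro u v w i j h h' hvw hi hj hjk hij
    have hne := hpv u v w h h' hvw
    rw [(hSG u w h').left j (by omega)]
    by_cases hik : i ≤ k + 1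
    · rw [(hSG u v h).left i hik]
      exact fpBall_star hk hne hi hik hj hjk
    · have hle := fpBall_le (k := k) (β := b u) (p := p u w) (a := f u) hjk
      rcases (hSG u v h).lvL i (by omega) (by omega) trivial with h1 | ⟨h1, h2⟩
      · intro e
        rw [← e] at hle
        omega
      · rw [h2]
        exact fpBall_ne_shift hj (by omega)

end FpMain

theorem chromatic_eq_clique_of_compatible {V : Type*} [Fintype V] (G : SimpleGraph V)
    [DecidableRel G.Adj] (hnc : G ≠ ⊤) (hΔ : 5 ≤ G.maxDegree)
    (m : ℕ) (hm : Odd m) (hm3 : 3 ≤ m)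
    (hcompat : ∃ (f : V → ℕ) (h : Sym2 (SubdivVert G 2) → ℕ),
      (∀ v, f v ∈ Finset.Icc 1 G.maxDegree) ∧
      (∀ u v : V, G.Adj u v → f u ≠ f v) ∧
      (∀ e ∈ (subdivision G 2).edgeSet, h e ∈ Finset.Icc 1 G.maxDegree) ∧
      IsProperEdgeColoring (subdivision G 2) h ∧
      (∀ (u v : V) (huv : G.Adj u v), h (halfEdge G huv) ≠ f v)) :
    ∀ n : ℕ, m < n →
      (fracPower G m n).chromaticNumber = (fracPower G m n).cliqueNum := by
  classical
  intro n hmn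
  obtain ⟨k, rfl⟩ := hm
  obtain ⟨f, h, hf, hfe, hh, hprop, hcomp⟩ := hcompat
  have hk : 1 ≤ k := by omega
  obtain ⟨p, hpdef⟩ : ∃ p : V → V → ℕ, ∀ u v (huv : G.Adj u v), p u v = h (halfEdge G huv) :=
    ⟨fun u v => if huv : G.Adj u v then h (halfEdge G huv) else 0, fun u v huv => by simp [huv]⟩
  have hp : ∀ u v, G.Adj u v → 1 ≤ p u v ∧ p u v ≤ G.maxDegree := by
    intro u v huv
    rw [hpdef u v huv]
    exact Finset.mem_Icc.1 (hh _ (fp_half_mem huv))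
  have hpv : ∀ u v w, G.Adj u v → G.Adj u w → v ≠ w → p u v ≠ p u w := by
    intro u v w huv huw hvw
    rw [hpdef u v huv, hpdef u w huw]
    refine hprop _ (fp_half_mem huv) _ (fp_half_mem huw) (fp_half_ne huv huw hvw)
      ⟨branchVertex G 2 u, ?_, ?_⟩ <;> simp [halfEdge]
  have hpe : ∀ u v, G.Adj u v → p u v ≠ p v u := by
    intro u v huv
    rw [hpdef u v huv, hpdef v u huv.symm]
    refine hprop _ (fp_half_mem huv) _ (fp_half_mem huv.symm) (fp_half_ne' huv)
      ⟨mkVert G 2 huv 1 (by omega), ?_, ?_⟩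
    · simp [halfEdge]
    · rw [fp_flip]
      simp [halfEdge]
  have hpf : ∀ u v, G.Adj u v → p u v ≠ f v := by
    intro u v huv
    rw [hpdef u v huv]
    exact hcomp u v huv
  have hcol : (fracPower G (2 * k + 1) n).Colorable (G.maxDegree * k + 2) := by
    by_cases hn : n = 2 * k + 2
    · subst hn
      exact fp_color_tight hk p hp hpv hpe
    · exact fp_color_loose hk (by omega) hΔ f p (fun v => Finset.mem_Icc.1 (hf v)) hfe hp hpv hpe hpf
  have hne : Nonempty V := by
    by_contra hcon
    rw [not_nonempty_iff] at hcon
    have : G.maxDegree = 0 := G.maxDegree_of_subsingleton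
    omega
  obtain ⟨u, hu⟩ := G.exists_maximal_degree_vertex
  have hclq := fp_clique (G := G) (n := n) (k := k) (by omega) u (by omega)
  rw [← hu] at hclq
  apply le_antisymm
  · refine hcol.chromaticNumber_le.trans ?_
    exact_mod_cast hclq
  · exact SimpleGraph.cliqueNum_le_chromaticNumber
end
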